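/- Let H be a real Hilbert space, V ⊆ H a compact set, P the closed convex hull of V, assumed to have diameter D > 0, and let f : H → ℝ be Fréchet differentiable, convex and L-smooth, with x* a minimizer of f over P. For every BPCG run on (f, V) and every integer T ≥ 1, the iterate x_T satisfies f(x_T) − f(x*) ≤ 4LD²/T. (Infinite-dimensional extension of Theorem 3.1, as claimed after its proof) -/

import Mathlib

open scoped RealInnerProductSpace BigOperators

attribute [local instance] Classical.propDecidable

noncomputable section

variable {H : Type*} [NormedAddCommGroup H] [InnerProductSpace ℝ H]

/-- A run of the Blended Pairwise Conditional Gradients (BPCG) algorithm on `(f, V)`,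
where `g` is the gradient of `f`.  It records the iterates `x t`, the active sets `S t`,
the weights `c t`, the away vertex `a t`, the local Frank-Wolfe vertex `s t`, the global
Frank-Wolfe vertex `w t` and the step sizes `lam t`. -/
structure BPCGRun (f : H → ℝ) (g : H → H) (V : Set H) where
  x : ℕ → H
  S : ℕ → Finset H
  c : ℕ → H → ℝ
  a : ℕ → H
  s : ℕ → H
  w : ℕ → H
  lam : ℕ → ℝ
  init_x : x 0 ∈ V
  init_S : S 0 = {x 0}
  init_c : c 0 (x 0) = 1
  S_subset : ∀ t, (S t : Set H) ⊆ V
  c_pos : ∀ t, ∀ v ∈ S t, 0 < c t v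
  c_le_one : ∀ t, ∀ v ∈ S t, c t v ≤ 1
  c_sum : ∀ t, ∑ v ∈ S t, c t v = 1
  x_eq : ∀ t, x t = ∑ v ∈ S t, c t v • v
  a_mem : ∀ t, a t ∈ S t
  a_max : ∀ t, ∀ v ∈ S t, ⟪g (x t), v⟫ ≤ ⟪g (x t), a t⟫
  s_mem : ∀ t, s t ∈ S t
  s_min : ∀ t, ∀ v ∈ S t, ⟪g (x t), s t⟫ ≤ ⟪g (x t), v⟫
  w_mem : ∀ t, w t ∈ V
  w_min : ∀ t, ∀ v ∈ V, ⟪g (x t), w t⟫ ≤ ⟪g (x t), v⟫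
  /-- Pairwise step: taken when `⟪∇f(x_t), a_t - s_t⟫ ≥ ⟪∇f(x_t), x_t - w_t⟫`. -/
  step_pairwise : ∀ t, ⟪g (x t), x t - w t⟫ ≤ ⟪g (x t), a t - s t⟫ →
    lam t ∈ Set.Icc (0 : ℝ) (c t (a t)) ∧
    (∀ μ ∈ Set.Icc (0 : ℝ) (c t (a t)),
      f (x t - lam t • (a t - s t)) ≤ f (x t - μ • (a t - s t))) ∧
    x (t + 1) = x t - lam t • (a t - s t) ∧
    (lam t < c t (a t) → S (t + 1) = S t) ∧
    (lam t = c t (a t) → S (t + 1) = (S t).erase (a t)) ∧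
    (∀ v, c (t + 1) v =
      c t v + (if v = s t then lam t else 0) - (if v = a t then lam t else 0))
  /-- Frank-Wolfe step: taken when `⟪∇f(x_t), a_t - s_t⟫ < ⟪∇f(x_t), x_t - w_t⟫`. -/
  step_fw : ∀ t, ⟪g (x t), a t - s t⟫ < ⟪g (x t), x t - w t⟫ →
    lam t ∈ Set.Icc (0 : ℝ) 1 ∧
    (∀ μ ∈ Set.Icc (0 : ℝ) 1,
      f (x t - lam t • (x t - w t)) ≤ f (x t - μ • (x t - w t))) ∧
    x (t + 1) = x t - lam t • (x t - w t) ∧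
    S (t + 1) = insert (w t) (S t) ∧
    (∀ v, c (t + 1) v = (1 - lam t) * c t v + (if v = w t then lam t else 0))

/-- First order convexity inequality. -/
lemma bpcg_grad_ineq (f : H → ℝ) (g : H → H)
    (hdiff : ∀ y, HasFDerivAt f (innerSL ℝ (g y)) y)
    (hconv : ConvexOn ℝ Set.univ f) (x y : H) : f x + ⟪g x, y - x⟫ ≤ f y := by
  have h1 : ConvexOn ℝ Set.univ (fun r : ℝ => f (AffineMap.lineMap x y r)) := by
    have := hconv.comp_affineMap (AffineMap.lineMap x y : ℝ →ᵃ[ℝ] H)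
    rw [Set.preimage_univ] at this
    exact this
  have h2 : HasDerivAt (fun r : ℝ => f (AffineMap.lineMap x y r)) ⟪g x, y - x⟫ 0 := by
    have hl : HasDerivAt (AffineMap.lineMap x y : ℝ → H) (y - x) 0 :=
      AffineMap.hasDerivAt_lineMap
    have hf : HasFDerivAt f (innerSL ℝ (g x)) (AffineMap.lineMap x y (0 : ℝ)) := by
      simpa using hdiff x
    have := hf.comp_hasDerivAt (0 : ℝ) hl
    simpa [Function.comp_def] using this
  have h3 := h1.le_slope_of_hasDerivAt (Set.mem_univ (0 : ℝ)) (Set.mem_univ (1 : ℝ))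
    zero_lt_one h2
  simp [slope_def_field] at h3
  linarith

/-- One step of the recursion. -/
lemma bpcg_arith (n : ℕ) (h h' C : ℝ) (hC : 0 ≤ C) (hn : n * h ≤ 2 * C)
    (hstep : ∀ μ ∈ Set.Icc (0 : ℝ) 1, h' ≤ h - μ * h + C / 2 * μ ^ 2) :
    ((n + 1 : ℕ) : ℝ) * h' ≤ 2 * C := by
  have hp : (0 : ℝ) ≤ n := Nat.cast_nonneg n
  have h2 : (0 : ℝ) < n + 2 := by linarith
  have hs := hstep (2 / (n + 2)) ⟨by positivity, by rw [div_le_one h2]; linarith⟩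
  have e : h - 2 / (n + 2) * h + C / 2 * (2 / ((n : ℝ) + 2)) ^ 2
      = (n * h * (n + 2) + 2 * C) / (n + 2) ^ 2 := by
    field_simp; ring
  rw [e, le_div_iff₀ (by positivity)] at hs
  have h3 : h' * ((n : ℝ) + 2) ^ 2 ≤ 2 * C * (n + 3) := by nlinarith
  have h4 : (n + 1) * h' * ((n : ℝ) + 2) ^ 2 ≤ 2 * C * (n + 2) ^ 2 := by
    have := mul_le_mul_of_nonneg_left h3 (by linarith : (0 : ℝ) ≤ n + 1)
    nlinarith
  push_cast
  exact le_of_mul_le_mul_right h4 (by positivity)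


/-- **Theorem 3.1, infinite-dimensional version.** Let `H` be a real Hilbert space,
`V ⊆ H` compact, `P` the closed convex hull of `V` with diameter `D > 0`, and `f`
differentiable, convex and `L`-smooth with minimizer `x*` over `P`. Every BPCG run on
`(f, V)` satisfies `f(x_T) - f(x*) ≤ 4LD²/T` for all `T ≥ 1`. -/
theorem bpcg_convergence_smooth_convex_hilbert [CompleteSpace H]
    (V : Set H) (hVcpt : IsCompact V)
    (D L : ℝ) (hD : Metric.diam (closure (convexHull ℝ V)) = D) (hDpos : 0 < D)
    (f : H → ℝ) (g : H → H)
    (hdiff : ∀ y, HasFDerivAt f (innerSL ℝ (g y)) y)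
    (hconv : ConvexOn ℝ Set.univ f)
    (hsmooth : ∀ x y, f y - f x - ⟪g x, y - x⟫ ≤ L / 2 * ‖y - x‖ ^ 2)
    (xstar : H) (hxstar : xstar ∈ closure (convexHull ℝ V))
    (hmin : ∀ y ∈ closure (convexHull ℝ V), f xstar ≤ f y)
    (run : BPCGRun f g V) (T : ℕ) (hT : 1 ≤ T) :
    f (run.x T) - f xstar ≤ 4 * L * D ^ 2 / (T : ℝ) := by
  have hPc : Convex ℝ (closure (convexHull ℝ V)) := (convex_convexHull ℝ V).closure
  have hVP : V ⊆ closure (convexHull ℝ V) :=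
    (subset_convexHull ℝ V).trans subset_closure
  have hPb : Bornology.IsBounded (closure (convexHull ℝ V)) :=
    (isBounded_convexHull.2 hVcpt.isBounded).closure
  have hnorm : ∀ y ∈ closure (convexHull ℝ V), ∀ z ∈ closure (convexHull ℝ V),
      ‖y - z‖ ≤ D := by
    intro y hy z hz
    rw [← dist_eq_norm, ← hD]
    exact Metric.dist_le_diam_of_mem hPb hy hz
  have hgrad := bpcg_grad_ineq f g hdiff hconv
  have hL : 0 ≤ L := by
    have : ∃ y z : H, y ≠ z := by
      by_contra hcon
      push Not at hcon
      have : Metric.diam (closure (convexHull ℝ V)) = 0 :=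
        Metric.diam_subsingleton (fun y _ z _ => hcon y z)
      linarith
    obtain ⟨y, z, hyz⟩ := this
    have h1 := hgrad y z
    have h2 := hsmooth y z
    have h3 : 0 < ‖z - y‖ ^ 2 := by
      have := norm_pos_iff.2 (sub_ne_zero.2 hyz.symm)
      positivity
    by_contra hneg
    push Not at hneg
    nlinarith [mul_pos (neg_pos.2 hneg) h3]
  have hxP : ∀ t, run.x t ∈ closure (convexHull ℝ V) := by
    intro t
    rw [run.x_eq t]
    exact hPc.sum_mem (fun v hv => (run.c_pos t v hv).le) (run.c_sum t)
      (fun v hv => hVP (run.S_subset t hv))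
  have hgap : ∀ t, f (run.x t) - f xstar ≤ ⟪g (run.x t), run.x t - run.w t⟫ := by
    intro t
    have h1 := hgrad (run.x t) xstar
    have h2 : closure (convexHull ℝ V) ⊆
        {y : H | ⟪g (run.x t), run.w t⟫ ≤ ⟪g (run.x t), y⟫} := by
      apply closure_minimal
      · apply convexHull_min
        · intro v hv
          exact run.w_min t v hv
        · exact convex_halfSpace_ge (innerSL ℝ (g (run.x t))).isLinear _
      · exact isClosed_le continuous_const (by fun_prop)
    have h3 := h2 hxstar
    simp only [Set.mem_ofPred_eq] at h3
    rw [inner_sub_right] at h1 ⊢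
    linarith
  have hC : 0 ≤ L * D ^ 2 := by positivity
  -- smoothness along a direction
  have hsm : ∀ (y d : H) (μ : ℝ), ‖d‖ ≤ D →
      f (y - μ • d) ≤ f y - μ * ⟪g y, d⟫ + L * D ^ 2 / 2 * μ ^ 2 := by
    intro y d μ hd
    have h1 := hsmooth y (y - μ • d)
    have e : y - μ • d - y = -(μ • d) := by abel
    rw [e, inner_neg_right, inner_smul_right, norm_neg, norm_smul, mul_pow,
      Real.norm_eq_abs, sq_abs] at h1
    have h2 : ‖d‖ ^ 2 ≤ D ^ 2 := by gcongr
    have h3 : L / 2 * (μ ^ 2 * ‖d‖ ^ 2) ≤ L / 2 * (μ ^ 2 * D ^ 2) := by gcongr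
    nlinarith
  have key : ∀ t, ∃ n : ℕ, (run.S t).card + t ≤ 1 + 2 * n ∧
      n * (f (run.x t) - f xstar) ≤ 2 * (L * D ^ 2) := by
    intro t
    induction t with
    | zero =>
      refine ⟨0, by simp [run.init_S], by simpa using hC⟩
    | succ t ih =>
      obtain ⟨n, hn1, hn2⟩ := ih
      have hgt := hgap t
      rcases le_or_gt ⟪g (run.x t), run.x t - run.w t⟫
        ⟪g (run.x t), run.a t - run.s t⟫ with hcase | hcase
      · obtain ⟨hlam, hls, hx, hS1, hS2, -⟩ := run.step_pairwise t hcase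
        rcases hlam.2.lt_or_eq with hlt | heq
        · -- descent step
          refine ⟨n + 1, by rw [hS1 hlt]; omega, ?_⟩
          refine bpcg_arith n _ _ _ hC hn2 ?_
          intro μ hμ
          have hd : ‖run.a t - run.s t‖ ≤ D :=
            hnorm _ (hVP (run.S_subset t (run.a_mem t))) _
              (hVP (run.S_subset t (run.s_mem t)))
          have hglob : f (run.x (t + 1)) ≤ f (run.x t - μ • (run.a t - run.s t)) := by
            rw [hx]
            rcases le_or_gt μ (run.c t (run.a t)) with hle | hgt
            · exact hls μ ⟨hμ.1, hle⟩
            · set Λ := run.c t (run.a t) with hΛ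
              set l := run.lam t with hl
              have hpos : 0 < μ - l := by linarith
              have hθ0 : 0 < (Λ - l) / (μ - l) := div_pos (by linarith) hpos
              have hθ1 : (Λ - l) / (μ - l) ≤ 1 := by
                rw [div_le_one hpos]; linarith
              set θ := (Λ - l) / (μ - l) with hθ
              have hθe : (1 - θ) * l + θ * μ = Λ := by
                have : θ * (μ - l) = Λ - l := by
                  rw [hθ]; field_simp
                linarith
              have hcv := hconv.2 (Set.mem_univ (run.x t - l • (run.a t - run.s t)))
                (Set.mem_univ (run.x t - μ • (run.a t - run.s t)))
                (by linarith : 0 ≤ 1 - θ) hθ0.le (by ring)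
              have e : (1 - θ) • (run.x t - l • (run.a t - run.s t)) +
                  θ • (run.x t - μ • (run.a t - run.s t)) =
                  run.x t - Λ • (run.a t - run.s t) := by
                rw [← hθe]; module
              rw [e] at hcv
              simp only [smul_eq_mul] at hcv
              have hmn := hls Λ ⟨by linarith [hlam.1], le_rfl⟩
              have : θ * f (run.x t - l • (run.a t - run.s t)) ≤
                θ * f (run.x t - μ • (run.a t - run.s t)) := by linarith
              exact le_of_mul_le_mul_left this hθ0
          have h1 := hsm (run.x t) _ μ hd
          have h2 := mul_le_mul_of_nonneg_left (hgt.trans hcase) hμ.1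
          linarith
        · -- drop step
          refine ⟨n, ?_, ?_⟩
          · rw [hS2 heq, Finset.card_erase_of_mem (run.a_mem t)]
            have := Finset.card_pos.2 ⟨_, run.a_mem t⟩
            omega
          · have h0 := hls 0 ⟨le_rfl, (run.c_pos t _ (run.a_mem t)).le⟩
            rw [← hx, zero_smul, sub_zero] at h0
            refine le_trans ?_ hn2
            gcongr
      · -- Frank-Wolfe step
        obtain ⟨hlam, hls, hx, hS, -⟩ := run.step_fw t hcase
        refine ⟨n + 1, ?_, ?_⟩
        · rw [hS]
          have := Finset.card_insert_le (run.w t) (run.S t)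
          omega
        · refine bpcg_arith n _ _ _ hC hn2 ?_
          intro μ hμ
          have h0 := hls μ hμ
          rw [← hx] at h0
          have h1 := hsm (run.x t) _ μ (hnorm _ (hxP t) _ (hVP (run.w_mem t)))
          have h2 := mul_le_mul_of_nonneg_left hgt hμ.1
          linarith
  obtain ⟨n, hn1, hn2⟩ := key T
  have hcard := Finset.card_pos.2 ⟨_, run.a_mem T⟩
  have hTn : T ≤ 2 * n := by omega
  have hTn' : (T : ℝ) ≤ 2 * n := by exact_mod_cast hTn
  have hTpos : (0 : ℝ) < T := by exact_mod_cast hT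
  have hh := hmin _ (hxP T)
  rw [le_div_iff₀ hTpos]
  have := mul_le_mul_of_nonneg_left hTn' (sub_nonneg.2 hh)
  linarith
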